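/- Let n ≥ 3 and 1 < p ≤ n/(n−2). Then the integral system (IE) has no positive solution: there are no positive continuous functions u, v on ℝⁿ and constants c₁, c₂ > 0 satisfying (IE). -/

import Mathlib

open MeasureTheory Real Filter

/-- `(u, v)` (with constants `c₁, c₂ > 0`) is a positive continuous solution of the
integral system `u(x) = c₁ ∫ u(y)^(p-1) v(y) |x-y|^(2-n) dy`,
`v(x) = c₂ ∫ u(y)^p |x-y|^(2-n) dy`; in particular the integrals are finite for every `x`. -/
def IsIESolution (n : ℕ) (p c₁ c₂ : ℝ) (u v : EuclideanSpace ℝ (Fin n) → ℝ) : Prop :=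
  0 < c₁ ∧ 0 < c₂ ∧ Continuous u ∧ Continuous v ∧ (∀ x, 0 < u x) ∧ (∀ x, 0 < v x) ∧
  (∀ x, Integrable (fun y => u y ^ (p - 1) * v y * ‖x - y‖ ^ (-((n : ℝ) - 2)))) ∧
  (∀ x, Integrable (fun y => u y ^ p * ‖x - y‖ ^ (-((n : ℝ) - 2)))) ∧
  (∀ x, u x = c₁ * ∫ y, u y ^ (p - 1) * v y * ‖x - y‖ ^ (-((n : ℝ) - 2))) ∧
  (∀ x, v x = c₂ * ∫ y, u y ^ p * ‖x - y‖ ^ (-((n : ℝ) - 2)))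

section PotentialEstimates

variable {n : ℕ}

/-- On a ball containing `x`, the Riesz kernel centred at `x` is bounded below by its value at
the diameter. -/
theorem rpow_mul_setIntegral_le_integral_mul_rpow [NeZero n] {f : EuclideanSpace ℝ (Fin n) → ℝ}
    (hf : Continuous f) (hf0 : ∀ y, 0 ≤ f y) {m R r : ℝ} (hm : 0 ≤ m) (hr : r ≤ R)
    {x : EuclideanSpace ℝ (Fin n)} (hx : ‖x‖ ≤ R)
    (hint : Integrable (fun y => f y * ‖x - y‖ ^ (-m))) :
    (2 * R) ^ (-m) * ∫ y in Metric.closedBall 0 r, f y ≤ ∫ y, f y * ‖x - y‖ ^ (-m) := by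
  have hball : IntegrableOn f (Metric.closedBall 0 r) :=
    hf.continuousOn.integrableOn_compact (isCompact_closedBall 0 r)
  have hset : ∫ y in Metric.closedBall 0 r, f y * ‖x - y‖ ^ (-m) ≤ ∫ y, f y * ‖x - y‖ ^ (-m) :=
    setIntegral_le_integral hint
      (Eventually.of_forall fun y => mul_nonneg (hf0 y) (rpow_nonneg (norm_nonneg _) _))
  refine le_trans ?_ hset
  rw [← integral_const_mul]
  refine setIntegral_mono_on_ae (hball.const_mul _) hint.integrableOn
    Metric.isClosed_closedBall.measurableSet ?_
  have hne : ∀ᵐ y : EuclideanSpace ℝ (Fin n), y ≠ x := by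
    simp [ae_iff]
  filter_upwards [hne] with y hy hyb
  rw [mul_comm]
  refine mul_le_mul_of_nonneg_left ?_ (hf0 y)
  have hy' : ‖y‖ ≤ r := by simpa using hyb
  refine rpow_le_rpow_of_nonpos (norm_pos_iff.2 (sub_ne_zero.2 hy.symm)) ?_ (by linarith)
  linarith [norm_sub_le x y]

theorem mul_pow_mul_le_setIntegral_closedBall {f : EuclideanSpace ℝ (Fin n) → ℝ}
    (hf : Continuous f) {c R : ℝ} (hR : 0 ≤ R) (h : ∀ y, ‖y‖ ≤ R → c ≤ f y) :
    c * (R ^ n * volume.real (Metric.closedBall (0 : EuclideanSpace ℝ (Fin n)) 1)) ≤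
      ∫ y in Metric.closedBall 0 R, f y := by
  have hball : IntegrableOn f (Metric.closedBall 0 R) :=
    hf.continuousOn.integrableOn_compact (isCompact_closedBall 0 R)
  have hv := Measure.addHaar_real_closedBall' (volume : Measure (EuclideanSpace ℝ (Fin n))) 0 hR
  rw [finrank_euclideanSpace_fin] at hv
  rw [← hv]
  exact setIntegral_ge_of_const_le_real Metric.isClosed_closedBall.measurableSet
    (isCompact_closedBall _ _).measure_lt_top.ne (fun y hy => h y (by simpa using hy)) hball

/-- Positive functions decaying no faster than `R⁻ⁿ` gain a fixed amount of mass on each dyadic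
annulus. -/
theorem setIntegral_closedBall_add_le_setIntegral_closedBall_two_mul (hn : 1 ≤ n)
    {f : EuclideanSpace ℝ (Fin n) → ℝ} (hf : Continuous f) {c R : ℝ} (hR : 0 < R) (hc : 0 ≤ c)
    (h : ∀ y, ‖y‖ ≤ 2 * R → c * ((2 * R) ^ n)⁻¹ ≤ f y) :
    (∫ y in Metric.closedBall 0 R, f y) +
        c * volume.real (Metric.closedBall (0 : EuclideanSpace ℝ (Fin n)) 1) / 2 ≤
      ∫ y in Metric.closedBall 0 (2 * R), f y := by
  set ω := volume.real (Metric.closedBall (0 : EuclideanSpace ℝ (Fin n)) 1)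
  have hω : 0 ≤ ω := measureReal_nonneg
  have hball : IntegrableOn f (Metric.closedBall 0 (2 * R)) :=
    hf.continuousOn.integrableOn_compact (isCompact_closedBall 0 _)
  have hsub : Metric.closedBall (0 : EuclideanSpace ℝ (Fin n)) R ⊆ Metric.closedBall 0 (2 * R) :=
    Metric.closedBall_subset_closedBall (by linarith)
  have hms : MeasurableSet (Metric.closedBall (0 : EuclideanSpace ℝ (Fin n)) R) :=
    Metric.isClosed_closedBall.measurableSet
  have hms2 : MeasurableSet (Metric.closedBall (0 : EuclideanSpace ℝ (Fin n)) (2 * R)) :=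
    Metric.isClosed_closedBall.measurableSet
  have hfin := (isCompact_closedBall (0 : EuclideanSpace ℝ (Fin n)) (2 * R)).measure_lt_top
    (μ := volume)
  have hdiff := setIntegral_sdiff hms hball hsub
  have hlow : c * ((2 * R) ^ n)⁻¹ * volume.real
      (Metric.closedBall (0 : EuclideanSpace ℝ (Fin n)) (2 * R) \ Metric.closedBall 0 R) ≤
      ∫ y in Metric.closedBall 0 (2 * R) \ Metric.closedBall 0 R, f y :=
    setIntegral_ge_of_const_le_real (hms2.diff hms)
      ((measure_mono Set.sdiff_subset).trans_lt hfin).ne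
      (fun y hy => h y (by simpa using hy.1)) (hball.mono_set Set.sdiff_subset)
  have hvol := measureReal_sdiff (μ := volume) hsub hms hfin.ne
  have hv := Measure.addHaar_real_closedBall' (volume : Measure (EuclideanSpace ℝ (Fin n))) 0
    hR.le
  have hv2 := Measure.addHaar_real_closedBall' (volume : Measure (EuclideanSpace ℝ (Fin n))) 0
    (show 0 ≤ 2 * R by linarith)
  rw [finrank_euclideanSpace_fin] at hv hv2
  rw [hvol, hv, hv2, hdiff] at hlow
  have hpow : 2 * R ^ n ≤ (2 * R) ^ n := by
    rw [mul_pow]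
    exact mul_le_mul_of_nonneg_right (le_self_pow₀ one_le_two (by lia)) (by positivity)
  have hP : 0 < (2 * R) ^ n := by positivity
  have key : c * ω / 2 ≤ c * ((2 * R) ^ n)⁻¹ * ((2 * R) ^ n * ω - R ^ n * ω) := by
    calc c * ω / 2 = c * ((2 * R) ^ n)⁻¹ * ((2 * R) ^ n * ω / 2) := by field_simp
      _ ≤ _ := by
        refine mul_le_mul_of_nonneg_left ?_ (by positivity)
        nlinarith
  linarith

end PotentialEstimates

theorem stmt_2 (n : ℕ) (hn : 3 ≤ n) (p : ℝ) (hp1 : 1 < p) (hp2 : p ≤ (n : ℝ) / ((n : ℝ) - 2)) :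
    ¬ ∃ (u v : EuclideanSpace ℝ (Fin n) → ℝ) (c₁ c₂ : ℝ), IsIESolution n p c₁ c₂ u v := by
  rintro ⟨u, v, c₁, c₂, hc₁, hc₂, hu, hv, hu0, hv0, hiu, hiv, hequ, heqv⟩
  have : NeZero n := ⟨by lia⟩
  have hn' : (3 : ℝ) ≤ n := by exact_mod_cast hn
  obtain ⟨m, hm⟩ : ∃ m : ℝ, m = (n : ℝ) - 2 := ⟨_, rfl⟩
  rw [← hm] at hp2 hiu hiv hequ heqv
  have hm0 : 0 < m := by linarith
  rw [le_div_iff₀ hm0] at hp2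
  have hq : 0 < p - 1 := by linarith
  set ω := volume.real (Metric.closedBall (0 : EuclideanSpace ℝ (Fin n)) 1) with hωdef
  have hω : 0 < ω := ENNReal.toReal_pos (Metric.measure_closedBall_pos _ _ one_pos).ne'
    (isCompact_closedBall _ _).measure_lt_top.ne
  have hup : Continuous fun y => u y ^ p := hu.rpow_const fun y => Or.inl (hu0 y).ne'
  have huq : Continuous fun y => u y ^ (p - 1) := hu.rpow_const fun y => Or.inl (hu0 y).ne'
  have huqv : Continuous fun y => u y ^ (p - 1) * v y := huq.mul hv
  have hup0 : ∀ y, 0 < u y ^ p := fun y => rpow_pos_of_pos (hu0 y) _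
  have huq0 : ∀ y, 0 < u y ^ (p - 1) := fun y => rpow_pos_of_pos (hu0 y) _
  have hpos : ∀ (f : EuclideanSpace ℝ (Fin n) → ℝ) (R : ℝ), Continuous f → (∀ y, 0 < f y) →
      0 < R → 0 < ∫ y in Metric.closedBall 0 R, f y := by
    intro f R hf hf0 hR
    obtain ⟨z, -, hz⟩ := (isCompact_closedBall (0 : EuclideanSpace ℝ (Fin n)) R).exists_isMinOn
      ⟨0, by simpa using hR.le⟩ hf.continuousOn
    refine lt_of_lt_of_le ?_ (mul_pow_mul_le_setIntegral_closedBall (c := f z) hf hR.le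
      fun y hy => hz (by simpa using hy))
    have := hf0 z
    positivity
  set I : ℝ → ℝ := fun R => ∫ y in Metric.closedBall 0 R, u y ^ p with hI
  set J : ℝ → ℝ := fun R => ∫ y in Metric.closedBall 0 R, u y ^ (p - 1) with hJ
  have hI0 : ∀ R, 0 < R → 0 < I R := fun R hR => hpos _ R hup hup0 hR
  have hJ0 : ∀ R, 0 < R → 0 < J R := fun R hR => hpos _ R huq huq0 hR
  set κ : ℝ := 2 ^ (-m) with hκdef
  have hκ : 0 < κ := by positivity
  have hκR : ∀ R : ℝ, 0 < R → (2 * R) ^ (-m) = κ * R ^ (-m) := fun R hR =>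
    mul_rpow zero_le_two hR.le
  have hIJ : ∀ R a : ℝ, (∀ y, ‖y‖ ≤ R → a ≤ u y) → a * J R ≤ I R := by
    intro R a ha
    simp only [hI, hJ]
    rw [← integral_const_mul]
    refine setIntegral_mono_on
      ((huq.continuousOn.integrableOn_compact (isCompact_closedBall 0 R)).const_mul _)
      (hup.continuousOn.integrableOn_compact (isCompact_closedBall 0 R))
      Metric.isClosed_closedBall.measurableSet fun y hy => ?_
    have h1 : u y ^ p = u y * u y ^ (p - 1) := by
      rw [rpow_sub_one (hu0 y).ne']
      field_simp [(hu0 y).ne']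
    rw [h1]
    exact mul_le_mul_of_nonneg_right (ha y (by simpa using hy)) (huq0 y).le
  have hvlow : ∀ R x, 0 < R → ‖x‖ ≤ R → c₂ * (κ * R ^ (-m) * I R) ≤ v x := by
    intro R x hR hx
    rw [heqv x, ← hκR R hR]
    exact mul_le_mul_of_nonneg_left (rpow_mul_setIntegral_le_integral_mul_rpow hup
      (fun y => (hup0 y).le) hm0.le le_rfl hx (hiv x)) hc₂.le
  have hulow : ∀ R x, 0 < R → ‖x‖ ≤ R →
      c₁ * c₂ * κ ^ 2 * (R ^ (-m)) ^ 2 * I R * J R ≤ u x := by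
    intro R x hR hx
    have h1 : c₂ * (κ * R ^ (-m) * I R) * J R ≤
        ∫ y in Metric.closedBall 0 R, u y ^ (p - 1) * v y := by
      simp only [hJ]
      rw [← integral_const_mul]
      refine setIntegral_mono_on
        ((huq.continuousOn.integrableOn_compact (isCompact_closedBall 0 R)).const_mul _)
        (huqv.continuousOn.integrableOn_compact (isCompact_closedBall 0 R))
        Metric.isClosed_closedBall.measurableSet fun y hy => ?_
      rw [mul_comm]
      exact mul_le_mul_of_nonneg_left (hvlow R y hR (by simpa using hy)) (huq0 y).le
    have h2 := rpow_mul_setIntegral_le_integral_mul_rpow huqv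
      (fun y => (mul_pos (huq0 y) (hv0 y)).le) hm0.le le_rfl hx (hiu x)
    rw [hequ x]
    calc _ = c₁ * (κ * R ^ (-m) * (c₂ * (κ * R ^ (-m) * I R) * J R)) := by ring
      _ ≤ c₁ * (κ * R ^ (-m) * ∫ y in Metric.closedBall 0 R, u y ^ (p - 1) * v y) := by gcongr
      _ ≤ _ := by
        rw [← hκR R hR]
        exact mul_le_mul_of_nonneg_left h2 hc₁.le
  obtain ⟨b, hb, hub⟩ : ∃ b > 0, ∀ R x, 1 ≤ R → ‖x‖ ≤ R → b * R ^ (-m) ≤ u x := by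
    refine ⟨c₁ * (κ * ∫ y in Metric.closedBall 0 1, u y ^ (p - 1) * v y), ?_, ?_⟩
    · have := hpos _ 1 huqv (fun y => mul_pos (huq0 y) (hv0 y)) one_pos
      positivity
    · intro R x hR hx
      have hR0 : 0 < R := by linarith
      have h2 := rpow_mul_setIntegral_le_integral_mul_rpow huqv
        (fun y => (mul_pos (huq0 y) (hv0 y)).le) hm0.le hR hx (hiu x)
      rw [hκR R hR0] at h2
      rw [hequ x]
      refine le_trans (le_of_eq ?_) (mul_le_mul_of_nonneg_left h2 hc₁.le)
      ring
  have hJlow : ∀ R a : ℝ, 1 ≤ R → 0 ≤ a → (∀ y, ‖y‖ ≤ R → a * R ^ (-m) ≤ u y) →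
      a ^ (p - 1) * ω * R ^ m ≤ J R := by
    intro R a hR ha hau
    have hR0 : 0 < R := by linarith
    refine le_trans ?_ (mul_pow_mul_le_setIntegral_closedBall (c := (a * R ^ (-m)) ^ (p - 1)) huq
      hR0.le fun y hy => rpow_le_rpow (by positivity) (hau y hy) hq.le)
    rw [mul_rpow ha (by positivity), ← rpow_mul hR0.le, ← rpow_natCast R n]
    calc a ^ (p - 1) * ω * R ^ m ≤ a ^ (p - 1) * ω * R ^ (-m * (p - 1) + n) := by
          gcongr
          linarith
      _ = _ := by rw [rpow_add hR0]; ring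
  have hgrow : ∀ k : ℕ, k * (b ^ p * ω / 2) ≤ I (2 ^ k) := by
    intro k
    induction k with
    | zero => simpa using (hI0 1 one_pos).le
    | succ k ih =>
      have hk : (1 : ℝ) ≤ 2 ^ k := one_le_pow₀ one_le_two
      have hk2 : (1 : ℝ) ≤ 2 * 2 ^ k := by linarith
      have := setIntegral_closedBall_add_le_setIntegral_closedBall_two_mul (by lia : 1 ≤ n) hup
        (c := b ^ p) (R := 2 ^ k) (by positivity) (by positivity) (fun y hy => by
          refine le_trans ?_ (rpow_le_rpow (by positivity) (hub _ y hk2 hy) (by linarith))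
          rw [mul_rpow hb.le (by positivity), ← rpow_mul (by positivity), ← rpow_natCast _ n,
            ← rpow_neg (by positivity)]
          gcongr
          linarith)
      push_cast
      rw [pow_succ' (2 : ℝ) k]
      simp only [hI] at ih ⊢
      linarith
  set L : ℝ := c₁ * c₂ * κ ^ 2 with hL
  have hL0 : 0 < L := by positivity
  have hRm : ∀ R : ℝ, 0 < R → R ^ (-m) * R ^ m = 1 := fun R hR => by
    rw [← rpow_add hR]; simp
  have hJup : ∀ R, 0 < R → L * (R ^ (-m) * J R) ^ 2 ≤ 1 := by
    intro R hR
    have h := hIJ R _ (fun y hy => hulow R y hR hy)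
    refine le_of_mul_le_mul_right ?_ (hI0 R hR)
    calc _ = L * (R ^ (-m)) ^ 2 * I R * J R * J R := by ring
      _ ≤ 1 * I R := by rwa [one_mul]
  set K : ℝ := L * (b ^ (p - 1) * ω) with hK
  have hK0 : 0 < K := by positivity
  have hbound : ∀ R, 1 ≤ R → L * ((K * I R) ^ (p - 1) * ω) ^ 2 ≤ 1 := by
    intro R hR
    have hR0 : 0 < R := by linarith
    have hIR := hI0 R hR0
    have h1 := hJlow R b hR hb.le (fun y hy => hub R y hR hy)
    have h2 : ∀ y, ‖y‖ ≤ R → K * I R * R ^ (-m) ≤ u y := by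
      intro y hy
      refine le_trans ?_ (hulow R y hR0 hy)
      calc K * I R * R ^ (-m) = K * I R * R ^ (-m) * (R ^ (-m) * R ^ m) := by
            rw [hRm R hR0, mul_one]
        _ = L * (R ^ (-m)) ^ 2 * I R * (b ^ (p - 1) * ω * R ^ m) := by rw [hK]; ring
        _ ≤ _ := by gcongr
    have h3 := hJlow R (K * I R) hR (by positivity) h2
    refine le_trans (mul_le_mul_of_nonneg_left (pow_le_pow_left₀ (by positivity) ?_ 2) hL0.le)
      (hJup R hR0)
    calc (K * I R) ^ (p - 1) * ω = R ^ (-m) * ((K * I R) ^ (p - 1) * ω * R ^ m) := by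
          linear_combination -((K * I R) ^ (p - 1) * ω) * hRm R hR0
      _ ≤ _ := by gcongr
  have hd : 0 < b ^ p * ω / 2 := by positivity
  have ht1 : Tendsto (fun k : ℕ => I (2 ^ k)) atTop atTop :=
    tendsto_atTop_mono hgrow (tendsto_natCast_atTop_atTop.atTop_mul_const hd)
  have ht2 : Tendsto (fun k : ℕ => L * ((K * I (2 ^ k)) ^ (p - 1) * ω) ^ 2) atTop atTop :=
    ((tendsto_pow_atTop two_ne_zero).comp
      (((tendsto_rpow_atTop hq).comp (ht1.const_mul_atTop hK0)).atTop_mul_const hω)).const_mul_atTop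
      hL0
  obtain ⟨k, hk⟩ := (ht2.eventually_gt_atTop 1).exists
  exact absurd (hbound (2 ^ k) (one_le_pow₀ one_le_two)) (not_le.2 hk)
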